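/- For every index j with 1 ≤ j ≤ L−1 and every (t,α) ∈ ℝ × ℝ^{L−1}, the Christoffel symbol Γ^0_{0j}(t,α) equals −p_j'(t) A(t,α) / (N(t) B(t) + A(t,α)²). -/

import Mathlib

/-!
Formalization of results from "A geometric approach to equilibrium selection":
the metric, Christoffel symbols and curvature of the equilibrium manifold of a
two-consumer exchange economy with `L` goods, parametrized by
`Φ(t,α) = (p_1(t),…,p_{L−1}(t), α_1,…,α_{L−1}, w(t) − Σ_m p_m(t) α_m)`.

Indices run over `Fin L`, where the index `0` corresponds to the coordinate
`x_0 = t` and an index `i ≠ 0` corresponds to the coordinate `x_i = α_i`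
(the component `α 0` of `α : Fin L → ℝ` is never used, so `α` is just a copy
of `ℝ^{L−1}` together with an irrelevant extra coordinate).
-/

open Matrix BigOperators

noncomputable section

namespace EqSelection

variable {L : ℕ}

/-- `A(t,α) = w'(t) − Σ_{m=1}^{L−1} p_m'(t) α_m`. -/
def eqA [NeZero L] (p : Fin L → ℝ → ℝ) (w : ℝ → ℝ) (t : ℝ) (α : Fin L → ℝ) : ℝ :=
  deriv w t - ∑ m ∈ Finset.univ \ {0}, deriv (p m) t * α m

/-- `A'(t,α) = w''(t) − Σ_{m=1}^{L−1} p_m''(t) α_m`. -/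
def eqA' [NeZero L] (p : Fin L → ℝ → ℝ) (w : ℝ → ℝ) (t : ℝ) (α : Fin L → ℝ) : ℝ :=
  deriv (deriv w) t - ∑ m ∈ Finset.univ \ {0}, deriv (deriv (p m)) t * α m

/-- `B(t) = Σ_{m=1}^{L−1} (p_m'(t))²`. -/
def eqB [NeZero L] (p : Fin L → ℝ → ℝ) (t : ℝ) : ℝ :=
  ∑ m ∈ Finset.univ \ {0}, (deriv (p m) t) ^ 2

/-- `N(t) = 1 + Σ_{m=1}^{L−1} (p_m(t))²`. -/
def eqN [NeZero L] (p : Fin L → ℝ → ℝ) (t : ℝ) : ℝ :=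
  1 + ∑ m ∈ Finset.univ \ {0}, (p m t) ^ 2

/-- `C(t) = Σ_{m=1}^{L−1} p_m'(t) p_m''(t)`. -/
def eqC [NeZero L] (p : Fin L → ℝ → ℝ) (t : ℝ) : ℝ :=
  ∑ m ∈ Finset.univ \ {0}, deriv (p m) t * deriv (deriv (p m)) t

/-- `P(t) = Σ_{m=1}^{L−1} p_m(t) p_m'(t)`. -/
def eqP [NeZero L] (p : Fin L → ℝ → ℝ) (t : ℝ) : ℝ :=
  ∑ m ∈ Finset.univ \ {0}, p m t * deriv (p m) t

/-- The induced metric matrix `g(t,α)`: `g_{00} = B + A²`, `g_{0i} = g_{i0} = −p_i A`,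
`g_{ij} = p_i p_j + δ_{ij}` for `i, j ≠ 0`. -/
def gMat [NeZero L] (p : Fin L → ℝ → ℝ) (w : ℝ → ℝ) (t : ℝ) (α : Fin L → ℝ) :
    Matrix (Fin L) (Fin L) ℝ :=
  Matrix.of fun i j =>
    if i = 0 then
      if j = 0 then eqB p t + (eqA p w t α) ^ 2 else -(p j t) * eqA p w t α
    else
      if j = 0 then -(p i t) * eqA p w t α
      else p i t * p j t + (if i = j then 1 else 0)

/-- Partial derivative with respect to the coordinate `x_k`, where `x_0 = t`
and `x_i = α_i` for `i ≠ 0`. -/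
def pder [NeZero L] (k : Fin L) (f : ℝ → (Fin L → ℝ) → ℝ) (t : ℝ) (α : Fin L → ℝ) : ℝ :=
  if k = 0 then deriv (fun s => f s α) t
  else deriv (fun s => f t (Function.update α k s)) (α k)

/-- Christoffel symbol
`Γ^k_{ij} = (1/2) Σ_{h=0}^{L−1} g^{hk} (∂g_{jh}/∂x_i + ∂g_{hi}/∂x_j − ∂g_{ij}/∂x_h)`,
written `christoffel p w i j k`.  (Here `g^{hk}` denotes the entries of the inverse
matrix of `g`, i.e. of `(gMat p w t α)⁻¹`.) -/
def christoffel [NeZero L] (p : Fin L → ℝ → ℝ) (w : ℝ → ℝ) (i j k : Fin L)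
    (t : ℝ) (α : Fin L → ℝ) : ℝ :=
  (1 / 2) * ∑ h : Fin L,
    (gMat p w t α)⁻¹ h k *
      (pder i (fun t' α' => gMat p w t' α' j h) t α
        + pder j (fun t' α' => gMat p w t' α' h i) t α
        - pder h (fun t' α' => gMat p w t' α' i j) t α)

/-- Curvature coefficient
`R^s_{ijk} = Σ_{m} Γ^m_{ik} Γ^s_{jm} − Σ_{m} Γ^m_{jk} Γ^s_{im} + ∂Γ^s_{ik}/∂x_j − ∂Γ^s_{jk}/∂x_i`,
written `curvR p w i j k s`. -/
def curvR [NeZero L] (p : Fin L → ℝ → ℝ) (w : ℝ → ℝ) (i j k s : Fin L)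
    (t : ℝ) (α : Fin L → ℝ) : ℝ :=
  (∑ m : Fin L, christoffel p w i k m t α * christoffel p w j m s t α)
    - (∑ m : Fin L, christoffel p w j k m t α * christoffel p w i m s t α)
    + pder j (christoffel p w i k s) t α - pder i (christoffel p w j k s) t α

/-- The coordinate tangent vectors `Φ_i(t,α) ∈ ℝ^{2L−1}` of the parametrization
`Φ(t,α) = (p_1(t),…,p_{L−1}(t), α_1,…,α_{L−1}, w(t) − Σ_m p_m(t) α_m)`:
`Φ_0 = (p_1',…,p_{L−1}', 0,…,0, A)`, and for `i ≠ 0` the vector `Φ_i` has entry `1`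
in position `(L−1)+i` (1-indexed), entry `−p_i` in the last position and `0` elsewhere. -/
def PhiVec [NeZero L] (p : Fin L → ℝ → ℝ) (w : ℝ → ℝ) (i : Fin L)
    (t : ℝ) (α : Fin L → ℝ) : Fin (2 * L - 1) → ℝ :=
  fun j =>
    if i = 0 then
      if h : (j : ℕ) < L - 1 then deriv (p ⟨(j : ℕ) + 1, by omega⟩) t
      else if (j : ℕ) = 2 * L - 2 then eqA p w t α else 0
    else
      if (j : ℕ) + 1 = (L - 1) + (i : ℕ) then 1
      else if (j : ℕ) = 2 * L - 2 then -(p i t) else 0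

/-- The matrix `M(t,α)` of Statement 2: `M_{00} = N`, `M_{0i} = M_{i0} = p_i A`,
`M_{ii} = (N − p_i²) B + A²`, `M_{ij} = −p_i p_j B` for `i ≠ j`, `i, j ≠ 0`. -/
def invNumer [NeZero L] (p : Fin L → ℝ → ℝ) (w : ℝ → ℝ) (t : ℝ) (α : Fin L → ℝ) :
    Matrix (Fin L) (Fin L) ℝ :=
  Matrix.of fun i j =>
    if i = 0 then
      if j = 0 then eqN p t else p j t * eqA p w t α
    else
      if j = 0 then p i t * eqA p w t α
      else if i = j then (eqN p t - (p i t) ^ 2) * eqB p t + (eqA p w t α) ^ 2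
      else -(p i t * p j t * eqB p t)

theorem sum_univ_eq_zero_add [NeZero L] (f : Fin L → ℝ) :
    ∑ h, f h = f 0 + ∑ h ∈ Finset.univ \ {0}, f h := by
  rw [← Finset.sum_sdiff (Finset.subset_univ ({0} : Finset (Fin L))), Finset.sum_singleton, add_comm]

theorem sum_sq_eq_eqN_sub_one [NeZero L] (p : Fin L → ℝ → ℝ) (t : ℝ) :
    ∑ m ∈ Finset.univ \ {0}, (p m t) ^ 2 = eqN p t - 1 := by
  simp [eqN]

theorem invNumer_apply_of_ne_zero [NeZero L] (p : Fin L → ℝ → ℝ) (w : ℝ → ℝ) (t : ℝ)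
    (α : Fin L → ℝ) {i j : Fin L} (hi : i ≠ 0) (hj : j ≠ 0) :
    invNumer p w t α i j = -(p i t * p j t * eqB p t) +
      if i = j then eqN p t * eqB p t + (eqA p w t α) ^ 2 else 0 := by
  by_cases hij : i = j
  · subst hij
    simp only [invNumer, Matrix.of_apply, hi, if_true, if_false]
    ring
  · simp [invNumer, hi, hj, hij]

theorem gMat_mul_invNumer [NeZero L] (p : Fin L → ℝ → ℝ) (w : ℝ → ℝ) (t : ℝ) (α : Fin L → ℝ) :
    gMat p w t α * invNumer p w t α = (eqN p t * eqB p t + (eqA p w t α) ^ 2) • 1 := by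
  have mem_of_ne {i : Fin L} (hi : i ≠ 0) : i ∈ Finset.univ \ {(0 : Fin L)} := by simp [hi]
  have ne_of_mem {i : Fin L} (hi : i ∈ Finset.univ \ {(0 : Fin L)}) : i ≠ 0 := by simpa using hi
  have hN := sum_sq_eq_eqN_sub_one p t
  ext i j
  rw [Matrix.mul_apply, sum_univ_eq_zero_add, Matrix.smul_apply, Matrix.one_apply, smul_eq_mul]
  by_cases hi : i = 0
  · subst hi
    by_cases hj : j = 0
    · subst hj
      have hsum : ∑ k ∈ Finset.univ \ {0}, gMat p w t α 0 k * invNumer p w t α k 0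
          = -(eqA p w t α) ^ 2 * (eqN p t - 1) := by
        rw [← hN, Finset.mul_sum]
        refine Finset.sum_congr rfl fun k hk => ?_
        simp only [gMat, invNumer, Matrix.of_apply, ne_of_mem hk, if_true, if_false]
        ring
      rw [hsum]
      simp only [gMat, invNumer, Matrix.of_apply, if_true]
      ring
    · have hsum : ∑ k ∈ Finset.univ \ {0}, gMat p w t α 0 k * invNumer p w t α k j
          = eqA p w t α * p j t * eqB p t * (eqN p t - 1)
            - p j t * eqA p w t α * (eqN p t * eqB p t + (eqA p w t α) ^ 2) := by
        have hterm : ∀ k ∈ Finset.univ \ {(0 : Fin L)},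
            gMat p w t α 0 k * invNumer p w t α k j
              = eqA p w t α * p j t * eqB p t * (p k t) ^ 2
                - if k = j then
                    p k t * eqA p w t α * (eqN p t * eqB p t + (eqA p w t α) ^ 2) else 0 := by
          intro k hk
          rw [invNumer_apply_of_ne_zero p w t α (ne_of_mem hk) hj]
          simp only [gMat, Matrix.of_apply, ne_of_mem hk, if_true, if_false]
          split_ifs <;> ring
        rw [Finset.sum_congr rfl hterm, Finset.sum_sub_distrib, ← Finset.mul_sum, hN,
          Finset.sum_ite_eq', if_pos (mem_of_ne hj)]
      rw [hsum, if_neg (Ne.symm hj)]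
      simp only [gMat, invNumer, Matrix.of_apply, hj, if_true, if_false]
      ring
  · have hg : ∀ k ∈ Finset.univ \ {(0 : Fin L)}, gMat p w t α i k * invNumer p w t α k j
        = p i t * (p k t * invNumer p w t α k j)
          + if i = k then invNumer p w t α k j else 0 := by
      intro k hk
      simp only [gMat, Matrix.of_apply, hi, ne_of_mem hk, if_false]
      split_ifs <;> ring
    rw [Finset.sum_congr rfl hg, Finset.sum_add_distrib, ← Finset.mul_sum, Finset.sum_ite_eq,
      if_pos (mem_of_ne hi)]
    by_cases hj : j = 0
    · subst hj
      have hsum : ∑ k ∈ Finset.univ \ {0}, p k t * invNumer p w t α k 0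
          = eqA p w t α * (eqN p t - 1) := by
        rw [← hN, Finset.mul_sum]
        refine Finset.sum_congr rfl fun k hk => ?_
        simp only [invNumer, Matrix.of_apply, ne_of_mem hk, if_true, if_false]
        ring
      rw [hsum]
      simp only [gMat, invNumer, Matrix.of_apply, hi, if_true, if_false]
      ring
    · have hsum : ∑ k ∈ Finset.univ \ {0}, p k t * invNumer p w t α k j
          = -(p j t * eqB p t) * (eqN p t - 1)
            + p j t * (eqN p t * eqB p t + (eqA p w t α) ^ 2) := by
        have hterm : ∀ k ∈ Finset.univ \ {(0 : Fin L)}, p k t * invNumer p w t α k j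
            = -(p j t * eqB p t) * (p k t) ^ 2
              + if k = j then p k t * (eqN p t * eqB p t + (eqA p w t α) ^ 2) else 0 := by
          intro k hk
          rw [invNumer_apply_of_ne_zero p w t α (ne_of_mem hk) hj]
          split_ifs <;> ring
        rw [Finset.sum_congr rfl hterm, Finset.sum_add_distrib, ← Finset.mul_sum, hN,
          Finset.sum_ite_eq', if_pos (mem_of_ne hj)]
      rw [hsum, invNumer_apply_of_ne_zero p w t α hi hj]
      simp only [gMat, invNumer, Matrix.of_apply, hi, hj, if_true, if_false]
      split_ifs <;> ring

theorem eqN_mul_eqB_add_sq_pos [NeZero L] (p : Fin L → ℝ → ℝ) (w : ℝ → ℝ) (t : ℝ)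
    (hreg : 0 < eqB p t ∨ deriv w t ≠ 0) (α : Fin L → ℝ) :
    0 < eqN p t * eqB p t + (eqA p w t α) ^ 2 := by
  have hN : 0 < eqN p t := by unfold eqN; positivity
  have hB : 0 ≤ eqB p t := by unfold eqB; positivity
  rcases hB.lt_or_eq with hB | hB
  · positivity
  · have hw : deriv w t ≠ 0 := hreg.resolve_left hB.not_lt
    have hp : ∀ m ∈ Finset.univ \ {(0 : Fin L)}, deriv (p m) t = 0 := by
      intro m hm
      have := (Finset.sum_eq_zero_iff_of_nonneg (fun m _ => sq_nonneg (deriv (p m) t))).1 hB.symm m hm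
      simpa using this
    have hA : eqA p w t α = deriv w t := by
      rw [eqA, Finset.sum_eq_zero fun m hm => by rw [hp m hm, zero_mul], sub_zero]
    rw [← hB, hA]
    positivity

theorem inv_gMat_eq_smul_invNumer [NeZero L] (p : Fin L → ℝ → ℝ) (w : ℝ → ℝ) (t : ℝ)
    (hreg : 0 < eqB p t ∨ deriv w t ≠ 0) (α : Fin L → ℝ) :
    (gMat p w t α)⁻¹ = (eqN p t * eqB p t + (eqA p w t α) ^ 2)⁻¹ • invNumer p w t α := by
  apply Matrix.inv_eq_right_inv
  rw [Matrix.mul_smul, gMat_mul_invNumer, smul_smul,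
    inv_mul_cancel₀ (eqN_mul_eqB_add_sq_pos p w t hreg α).ne', one_smul]

theorem hasDerivAt_eqA_update [NeZero L] (p : Fin L → ℝ → ℝ) (w : ℝ → ℝ) (t : ℝ)
    (α : Fin L → ℝ) {k : Fin L} (hk : k ≠ 0) :
    HasDerivAt (fun s => eqA p w t (Function.update α k s)) (-deriv (p k) t) (α k) := by
  have hterm : ∀ m ∈ Finset.univ \ {(0 : Fin L)},
      HasDerivAt (fun s => deriv (p m) t * Function.update α k s m)
        (if m = k then deriv (p m) t else 0) (α k) := by
    intro m _
    by_cases hmk : m = k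
    · subst hmk
      simpa using (hasDerivAt_id (α m)).const_mul (deriv (p m) t)
    · simpa [hmk] using hasDerivAt_const (α k) (deriv (p m) t * α m)
  have h := (HasDerivAt.fun_sum hterm).const_sub (deriv w t)
  rw [Finset.sum_ite_eq', if_pos (by simp [hk])] at h
  exact h

theorem pder_gMat_zero_zero [NeZero L] (p : Fin L → ℝ → ℝ) (w : ℝ → ℝ) (t : ℝ)
    (α : Fin L → ℝ) {k : Fin L} (hk : k ≠ 0) :
    pder k (fun t' α' => gMat p w t' α' 0 0) t α = -2 * deriv (p k) t * eqA p w t α := by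
  simp only [pder, hk, if_false, gMat, Matrix.of_apply, if_true]
  have h := ((hasDerivAt_eqA_update p w t α hk).fun_pow 2).const_add (eqB p t)
  rw [h.deriv, Function.update_eq_self]
  push_cast
  ring

theorem pder_gMat_zero_right [NeZero L] (p : Fin L → ℝ → ℝ) (w : ℝ → ℝ) (t : ℝ)
    (α : Fin L → ℝ) {i k : Fin L} (hi : i ≠ 0) (hk : k ≠ 0) :
    pder k (fun t' α' => gMat p w t' α' i 0) t α = p i t * deriv (p k) t := by
  simp only [pder, hk, hi, if_false, gMat, Matrix.of_apply, if_true]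
  rw [((hasDerivAt_eqA_update p w t α hk).const_mul (-p i t)).deriv]
  ring

theorem gMat_symm [NeZero L] (p : Fin L → ℝ → ℝ) (w : ℝ → ℝ) (t : ℝ) (α : Fin L → ℝ)
    (i j : Fin L) : gMat p w t α i j = gMat p w t α j i := by
  simp only [gMat, Matrix.of_apply, eq_comm (a := i) (b := j), mul_comm (p i t) (p j t)]
  split_ifs <;> simp_all

theorem pder_zero_gMat [NeZero L] (p : Fin L → ℝ → ℝ) (w : ℝ → ℝ) (t : ℝ)
    (α : Fin L → ℝ) {i j : Fin L} (hi : i ≠ 0) (hj : j ≠ 0)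
    (hpi : DifferentiableAt ℝ (p i) t) (hpj : DifferentiableAt ℝ (p j) t) :
    pder 0 (fun t' α' => gMat p w t' α' i j) t α
      = deriv (p i) t * p j t + p i t * deriv (p j) t := by
  simp only [pder, hj, hi, if_false, gMat, Matrix.of_apply, if_true]
  exact ((hpi.hasDerivAt.mul hpj.hasDerivAt).add_const _).deriv

theorem statement_6 (L : ℕ) [NeZero L] (hL : 2 ≤ L)
    (p : Fin L → ℝ → ℝ) (w : ℝ → ℝ)
    (hp : ∀ i, ContDiff ℝ (⊤ : ℕ∞) (p i)) (hw : ContDiff ℝ (⊤ : ℕ∞) w)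
    (hreg : ∀ t : ℝ, 0 < eqB p t ∨ deriv w t ≠ 0) :
    ∀ j : Fin L, j ≠ 0 →
      ∀ (t : ℝ) (α : Fin L → ℝ),
        christoffel p w 0 j 0 t α
          = -(deriv (p j) t) * eqA p w t α / (eqN p t * eqB p t + (eqA p w t α) ^ 2) := by
  intro j hj t α
  have hdiff (i : Fin L) : DifferentiableAt ℝ (p i) t := (hp i).differentiable (by simp) t
  rw [christoffel, sum_univ_eq_zero_add, inv_gMat_eq_smul_invNumer p w t (hreg t) α]
  simp only [gMat_symm p w _ _ 0 j]
  have hsum : ∀ h ∈ Finset.univ \ {(0 : Fin L)},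
      ((eqN p t * eqB p t + (eqA p w t α) ^ 2)⁻¹ • invNumer p w t α) h 0 *
        (pder 0 (fun t' α' => gMat p w t' α' j h) t α
          + pder j (fun t' α' => gMat p w t' α' h 0) t α
          - pder h (fun t' α' => gMat p w t' α' j 0) t α)
        = (eqN p t * eqB p t + (eqA p w t α) ^ 2)⁻¹ * 2 * eqA p w t α * deriv (p j) t
          * (p h t) ^ 2 := by
    intro h hh
    have hh0 : h ≠ 0 := by simpa using hh
    rw [pder_zero_gMat p w t α hj hh0 (hdiff j) (hdiff h), pder_gMat_zero_right p w t α hh0 hj,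
      pder_gMat_zero_right p w t α hj hh0]
    simp only [Matrix.smul_apply, smul_eq_mul, invNumer, Matrix.of_apply, hh0, if_true, if_false]
    ring
  rw [Finset.sum_congr rfl hsum, ← Finset.mul_sum, sum_sq_eq_eqN_sub_one,
    pder_gMat_zero_zero p w t α hj]
  simp only [Matrix.smul_apply, smul_eq_mul, invNumer, Matrix.of_apply, if_true]
  ring

end EqSelection
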